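/- Fix N ≥ 1, 0 < b < min{2,N}, p > 1, and let u be a classical Schwartz solution of (INLS) on an interval J. Let φ : ℝ^N → ℝ be of class C⁴ with ∇φ(0) = 0 and with each partial derivative of φ of order ≤ 4 bounded by C(1+|x|)^m for some constants C, m. Then I(t) = ∫ φ|u(t,·)|² dx is twice differentiable on J with I''(t) = 4 Re ∑_{j,k=1}^N ∫ ∂_j∂_kφ · ∂_ju(t) ∂_k conj(u(t)) dx − ∫ |u(t)|² Δ²φ dx − (2(p−1)/(p+1)) ∫ |x|^{-b} |u(t)|^{p+1} Δφ dx + (4/(p+1)) ∫ ∇(|x|^{-b})·∇φ · |u(t)|^{p+1} dx, where ∇(|x|^{-b}) = −b|x|^{-b−2}x and Δ²φ is the bilaplacian of φ. -/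

import Mathlib

open MeasureTheory Set
open scoped BigOperators

noncomputable section

/-- The Laplacian of a complex-valued function on `ℝ^N`, computed as the sum of the repeated
directional derivatives along the standard basis vectors. -/
def lap {N : ℕ} (f : EuclideanSpace ℝ (Fin N) → ℂ) (x : EuclideanSpace ℝ (Fin N)) : ℂ :=
  ∑ i : Fin N, fderiv ℝ (fun y => fderiv ℝ f y (EuclideanSpace.single i 1)) x
      (EuclideanSpace.single i 1)

/-- The squared euclidean norm `|∇f(x)|²` of the gradient of `f : ℝ^N → ℂ` at `x`. -/
def gradNormSq {N : ℕ} (f : EuclideanSpace ℝ (Fin N) → ℂ) (x : EuclideanSpace ℝ (Fin N)) : ℝ :=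
  ∑ i : Fin N, ‖fderiv ℝ f x (EuclideanSpace.single i 1)‖ ^ 2

/-- A classical Schwartz solution of the inhomogeneous nonlinear Schrödinger equation
`i ∂ₜ u + Δu + |x|^{-b} |u|^{p-1} u = 0` on a time interval `J`:
for each time `t` the spatial profile `u t` is a Schwartz function, `u` is jointly
continuous on `J × ℝ^N`, jointly smooth on `J × (ℝ^N \ {0})`, the Schwartz seminorms of
`u t` are bounded uniformly for `t` in compact subsets of `J`, and the equation holds for
all `t ∈ J` and `x ≠ 0`. -/
structure INLSSolution (N : ℕ) (b p : ℝ) (J : Set ℝ) where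
  u : ℝ → SchwartzMap (EuclideanSpace ℝ (Fin N)) ℂ
  cont : ContinuousOn (fun q : ℝ × EuclideanSpace ℝ (Fin N) => u q.1 q.2) (J ×ˢ univ)
  smooth : ContDiffOn ℝ (⊤ : ℕ∞) (fun q : ℝ × EuclideanSpace ℝ (Fin N) => u q.1 q.2)
      (J ×ˢ {x : EuclideanSpace ℝ (Fin N) | x ≠ 0})
  seminorm_bound : ∀ K : Set ℝ, K ⊆ J → IsCompact K → ∀ k n : ℕ,
      ∃ C : ℝ, ∀ t ∈ K, SchwartzMap.seminorm ℝ k n (u t) ≤ C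
  eqn : ∀ t ∈ J, ∀ x : EuclideanSpace ℝ (Fin N), x ≠ 0 → ∃ ut' : ℂ,
      HasDerivWithinAt (fun s => u s x) ut' J t ∧
      Complex.I * ut' + lap (fun y => u t y) x +
        ((‖x‖ ^ (-b) * ‖u t x‖ ^ (p - 1) : ℝ) : ℂ) * u t x = 0

/-- The Laplacian of a real-valued function on `ℝ^N`, computed as the sum of the repeated
directional derivatives along the standard basis vectors. -/
def lapR {N : ℕ} (f : EuclideanSpace ℝ (Fin N) → ℝ) (x : EuclideanSpace ℝ (Fin N)) : ℝ :=
  ∑ i : Fin N, fderiv ℝ (fun y => fderiv ℝ f y (EuclideanSpace.single i 1)) x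
      (EuclideanSpace.single i 1)

/-- The virial functional `K(v) = ∫|∇v|² dx − ((N(p−1)+2b)/(2(p+1))) ∫ |x|^{-b}|v|^{p+1} dx`. -/
def Kq (N : ℕ) (b p : ℝ) (v : EuclideanSpace ℝ (Fin N) → ℂ) : ℝ :=
  (∫ x : EuclideanSpace ℝ (Fin N), gradNormSq v x) -
    (((N : ℝ) * (p - 1) + 2 * b) / (2 * (p + 1))) *
      ∫ x : EuclideanSpace ℝ (Fin N), ‖x‖ ^ (-b) * ‖v x‖ ^ (p + 1)

open SchwartzMap LineDeriv Filter Topology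

/-- Euclidean space of dimension `N`. -/
abbrev Euc (N : ℕ) := EuclideanSpace ℝ (Fin N)

/-- The `k`-th standard basis vector. -/
abbrev stdVec {N : ℕ} (k : Fin N) : Euc N := EuclideanSpace.single k 1

/-- The `k`-th partial derivative of a real function. -/
def pd {N : ℕ} (k : Fin N) (f : Euc N → ℝ) (x : Euc N) : ℝ := fderiv ℝ f x (stdVec k)

/-- The `k`-th partial derivative of a Schwartz function. -/
def sd {N : ℕ} (k : Fin N) (f : 𝓢(Euc N, ℂ)) : 𝓢(Euc N, ℂ) := ∂_{stdVec k} f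

/-- An integrable majorant with the singularity `‖x‖^(-b)` at the origin. -/
def majorant (N : ℕ) (b : ℝ) (x : Euc N) : ℝ :=
  (1 + ‖x‖ ^ (-b)) * (1 + ‖x‖) ^ (-((N : ℝ) + 1))

lemma integrable_majorant {N : ℕ} (hN : 1 ≤ N) {b : ℝ} (hb0 : 0 < b) (hb : b < N) :
    Integrable (majorant N b) := by
  have : Nonempty (Fin N) := ⟨⟨0, hN⟩⟩
  have key := integrable_fun_norm_addHaar (E := Euc N) volume
    (f := fun y : ℝ => (1 + y ^ (-b)) * (1 + y) ^ (-((N : ℝ) + 1)))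
  refine key.2 ?_
  rw [finrank_euclideanSpace_fin]
  have meas : Measurable
      (fun y : ℝ => y ^ (N - 1) • ((1 + y ^ (-b)) * (1 + y) ^ (-((N : ℝ) + 1)))) := by
    fun_prop
  have cast : ((N - 1 : ℕ) : ℝ) = N - 1 := by push_cast [hN]; ring
  rw [← Ioc_union_Ioi_eq_Ioi zero_le_one]
  refine IntegrableOn.union ?_ ?_
  · have h : IntegrableOn (fun y : ℝ => 2 * y ^ ((N : ℝ) - 1 - b)) (Ioc 0 1) := by
      have := intervalIntegral.intervalIntegrable_rpow' (a := 0) (b := 1)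
        (r := (N : ℝ) - 1 - b) (by linarith)
      exact ((intervalIntegrable_iff_integrableOn_Ioc_of_le zero_le_one).1 this).const_mul 2
    refine Integrable.mono' h meas.aestronglyMeasurable ?_
    refine (ae_restrict_iff' measurableSet_Ioc).2 (Eventually.of_forall fun y hy => ?_)
    have hy0 : 0 < y := hy.1
    have h1 : (1 + y) ^ (-((N : ℝ) + 1)) ≤ 1 :=
      Real.rpow_le_one_of_one_le_of_nonpos (by linarith)
        (by linarith [(Nat.cast_nonneg N : (0 : ℝ) ≤ N)])
    have h2 : 1 ≤ y ^ (-b) :=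
      Real.one_le_rpow_of_pos_of_le_one_of_nonpos hy0 hy.2 (by linarith)
    have h3 : y ^ ((N : ℝ) - 1 - b) = y ^ (N - 1) * y ^ (-b) := by
      rw [← Real.rpow_natCast, ← Real.rpow_add hy0, cast]; ring_nf
    rw [h3, Real.norm_of_nonneg (by positivity), smul_eq_mul]
    have : (1 + y ^ (-b)) * (1 + y) ^ (-((N : ℝ) + 1)) ≤ (2 * y ^ (-b)) * 1 := by
      gcongr; linarith
    calc _ ≤ y ^ (N - 1) * ((2 * y ^ (-b)) * 1) := by gcongr
      _ = _ := by ring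
  · have h : IntegrableOn (fun y : ℝ => 2 * y ^ (-2 : ℝ)) (Ioi 1) :=
      (integrableOn_Ioi_rpow_of_lt (by norm_num) zero_lt_one).const_mul 2
    refine Integrable.mono' h meas.aestronglyMeasurable ?_
    refine (ae_restrict_iff' measurableSet_Ioi).2 (Eventually.of_forall fun y hy => ?_)
    have hy1 : 1 < y := hy
    have hy0 : 0 < y := by linarith
    have h1 : (1 + y) ^ (-((N : ℝ) + 1)) ≤ y ^ (-((N : ℝ) + 1)) :=
      Real.rpow_le_rpow_of_nonpos hy0 (by linarith)
        (by linarith [(Nat.cast_nonneg N : (0 : ℝ) ≤ N)])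
    have h2 : y ^ (-b) ≤ 1 := Real.rpow_le_one_of_one_le_of_nonpos hy1.le (by linarith)
    have h3 : y ^ (-2 : ℝ) = y ^ (N - 1) * y ^ (-((N : ℝ) + 1)) := by
      rw [← Real.rpow_natCast, ← Real.rpow_add hy0, cast]; ring_nf
    rw [h3, Real.norm_of_nonneg (by positivity), smul_eq_mul]
    have : (1 + y ^ (-b)) * (1 + y) ^ (-((N : ℝ) + 1)) ≤ 2 * y ^ (-((N : ℝ) + 1)) := by
      gcongr; linarith
    calc _ ≤ y ^ (N - 1) * (2 * y ^ (-((N : ℝ) + 1))) := by gcongr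
      _ = _ := by ring

lemma ae_ne_zero {N : ℕ} (hN : 1 ≤ N) : ∀ᵐ x : Euc N, x ≠ 0 := by
  have : Nonempty (Fin N) := ⟨⟨0, hN⟩⟩
  simp [ae_iff]

lemma integrable_of_le_majorant {N : ℕ} (hN : 1 ≤ N) {b : ℝ} (hb0 : 0 < b) (hb : b < N)
    {F : Type*} [NormedAddCommGroup F] {f : Euc N → F} (hf : AEStronglyMeasurable f)
    (C : ℝ) (h : ∀ x, x ≠ 0 → ‖f x‖ ≤ C * majorant N b x) : Integrable f :=
  ((integrable_majorant hN hb0 hb).const_mul C).mono' hf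
    ((ae_ne_zero hN).mono fun x hx => h x hx)

/-- `f` is of class `C^n` and its derivatives up to order `n` grow at most polynomially. -/
structure PolyGrowth {N : ℕ} (n : ℕ) (f : Euc N → ℝ) : Prop where
  contDiff : ContDiff ℝ n f
  bound : ∃ (C : ℝ) (m : ℕ), ∀ k ≤ n, ∀ x, ‖iteratedFDeriv ℝ k f x‖ ≤ C * (1 + ‖x‖) ^ m

namespace PolyGrowth
variable {N n : ℕ} {f g : Euc N → ℝ}

lemma mono (h : PolyGrowth n f) {m : ℕ} (hm : m ≤ n) : PolyGrowth m f :=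
  ⟨h.contDiff.of_le (by exact_mod_cast hm),
    let ⟨C, M, hC⟩ := h.bound; ⟨C, M, fun k hk => hC k (hk.trans hm)⟩⟩

lemma partialDeriv (h : PolyGrowth (n + 1) f) (j : Fin N) : PolyGrowth n (pd j f) := by
  have hf' : ContDiff ℝ n (fderiv ℝ f) := h.contDiff.fderiv_right (by norm_cast)
  refine ⟨hf'.clm_apply contDiff_const, ?_⟩
  obtain ⟨C, M, hC⟩ := h.bound
  refine ⟨C, M, fun k hk x => ?_⟩
  have := norm_iteratedFDeriv_clm_apply_const (c := (stdVec j : Euc N)) (hf'.contDiffAt (x := x))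
    (by exact_mod_cast hk : (k : WithTop ℕ∞) ≤ n)
  rw [norm_iteratedFDeriv_fderiv] at this
  refine this.trans ?_
  simpa using hC (k + 1) (by omega) x

lemma add (hf : PolyGrowth n f) (hg : PolyGrowth n g) : PolyGrowth n (fun x => f x + g x) := by
  refine ⟨hf.contDiff.add hg.contDiff, ?_⟩
  obtain ⟨C, M, hC⟩ := hf.bound
  obtain ⟨C', M', hC'⟩ := hg.bound
  refine ⟨|C| + |C'|, max M M', fun k hk x => ?_⟩
  have := iteratedFDeriv_add_apply (i := k) (x := x)
    (hf.contDiff.contDiffAt.of_le (by exact_mod_cast hk))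
    (hg.contDiff.contDiffAt.of_le (by exact_mod_cast hk))
  have h1 : (1 : ℝ) ≤ 1 + ‖x‖ := by linarith [norm_nonneg x]
  change ‖iteratedFDeriv ℝ k (f + g) x‖ ≤ _
  rw [this, add_mul]
  refine (norm_add_le _ _).trans (add_le_add ((hC k hk x).trans ?_) ((hC' k hk x).trans ?_))
  · gcongr
    · exact le_abs_self C
    · exact le_max_left _ _
  · gcongr
    · exact le_abs_self C'
    · exact le_max_right _ _

lemma zero : PolyGrowth n (fun _ : Euc N => (0 : ℝ)) :=
  ⟨contDiff_const, 0, 0, fun k _ x => by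
    have : (fun _ : Euc N => (0 : ℝ)) = 0 := rfl
    simp [this]⟩

lemma sum {ι : Type*} (s : Finset ι) {f : ι → Euc N → ℝ} (h : ∀ i, PolyGrowth n (f i)) :
    PolyGrowth n (fun x => ∑ i ∈ s, f i x) := by
  classical
  induction s using Finset.induction_on with
  | empty => simpa using zero
  | insert a s ha ih => simpa [Finset.sum_insert ha] using (h a).add ih

lemma laplacian (h : PolyGrowth (n + 2) f) : PolyGrowth n (lapR f) :=
  sum Finset.univ fun i => PolyGrowth.partialDeriv (PolyGrowth.partialDeriv (n := n + 1) h i) i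

lemma continuous (h : PolyGrowth n f) : Continuous f := h.contDiff.continuous

lemma norm_le (h : PolyGrowth n f) : ∃ (C : ℝ) (m : ℕ), 0 ≤ C ∧ ∀ x, ‖f x‖ ≤ C * (1 + ‖x‖) ^ m := by
  obtain ⟨C, M, hC⟩ := h.bound
  refine ⟨C, M, ?_, fun x => by simpa using hC 0 (Nat.zero_le _) x⟩
  simpa using (norm_nonneg _).trans (hC 0 (Nat.zero_le _) 0)

lemma hasLineDerivAt (h : PolyGrowth (n + 1) f) (k : Fin N) (x : Euc N) :
    HasLineDerivAt ℝ f (pd k f x) x (stdVec k) :=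
  ((h.contDiff.differentiable (by norm_cast)) x).hasFDerivAt.hasLineDerivAt _

end PolyGrowth

section Schwartz
variable {N : ℕ}

lemma one_add_pow_mul_le_seminorm (f : 𝓢(Euc N, ℂ)) (k n : ℕ) (x : Euc N) :
    (1 + ‖x‖) ^ k * ‖iteratedFDeriv ℝ n f x‖ ≤
      2 ^ (k - 1) * (SchwartzMap.seminorm ℝ 0 n f + SchwartzMap.seminorm ℝ k n f) := by
  have h0 := SchwartzMap.le_seminorm ℝ 0 n f x
  have hk := SchwartzMap.le_seminorm ℝ k n f x
  have := add_pow_le zero_le_one (norm_nonneg x) k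
  calc _ ≤ (2 ^ (k - 1) * (1 ^ k + ‖x‖ ^ k)) * ‖iteratedFDeriv ℝ n f x‖ := by gcongr
    _ = 2 ^ (k - 1) *
        (‖x‖ ^ 0 * ‖iteratedFDeriv ℝ n f x‖ + ‖x‖ ^ k * ‖iteratedFDeriv ℝ n f x‖) := by
      ring
    _ ≤ _ := by gcongr

lemma exists_one_add_pow_mul_le (f : 𝓢(Euc N, ℂ)) (k : ℕ) :
    ∃ C : ℝ, 0 ≤ C ∧ ∀ x, (1 + ‖x‖) ^ k * ‖f x‖ ≤ C :=
  ⟨2 ^ (k - 1) * (SchwartzMap.seminorm ℝ 0 0 f + SchwartzMap.seminorm ℝ k 0 f),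
    by positivity, fun x => by simpa using one_add_pow_mul_le_seminorm f k 0 x⟩

lemma exists_norm_le (f : 𝓢(Euc N, ℂ)) : ∃ C : ℝ, 0 ≤ C ∧ ∀ x, ‖f x‖ ≤ C := by
  simpa using exists_one_add_pow_mul_le f 0

lemma sd_apply (k : Fin N) (f : 𝓢(Euc N, ℂ)) (x : Euc N) : sd k f x = fderiv ℝ f x (stdVec k) :=
  SchwartzMap.lineDerivOp_apply_eq_fderiv _ _ _

lemma norm_sd_le (k : Fin N) (f : 𝓢(Euc N, ℂ)) (x : Euc N) :
    ‖sd k f x‖ ≤ ‖iteratedFDeriv ℝ 1 f x‖ := by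
  rw [sd_apply, norm_iteratedFDeriv_one]
  simpa using (fderiv ℝ f x).le_opNorm (stdVec k)

lemma norm_sd_sd_le (j k : Fin N) (f : 𝓢(Euc N, ℂ)) (x : Euc N) :
    ‖sd j (sd k f) x‖ ≤ ‖iteratedFDeriv ℝ 2 f x‖ := by
  refine (norm_sd_le j _ x).trans ?_
  have h := norm_iteratedFDeriv_clm_apply_const (c := (stdVec k : Euc N)) (n := 1) (N := 1) (x := x)
    (((f.smooth 2).fderiv_right (by norm_num)).contDiffAt) le_rfl
  rw [norm_iteratedFDeriv_fderiv] at h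
  have e : (sd k f : Euc N → ℂ) = fun y => fderiv ℝ f y (stdVec k) := funext (sd_apply k f)
  rw [e]
  simpa using h

lemma sd_comm (j k : Fin N) (f : 𝓢(Euc N, ℂ)) : sd j (sd k f) = sd k (sd j f) := by
  ext x
  have hd : DifferentiableAt ℝ (fderiv ℝ f) x :=
    ((f.smooth 2).fderiv_right (m := 1) (by norm_num)).differentiable (by norm_num) x
  have e (i l : Fin N) : sd i (sd l f) x = fderiv ℝ (fderiv ℝ f) x (stdVec i) (stdVec l) := by
    have : (sd l f : Euc N → ℂ) = fun y => fderiv ℝ f y (stdVec l) := funext (sd_apply l f)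
    rw [sd_apply, this, fderiv_clm_apply hd (differentiableAt_const _)]
    simp
  rw [e, e]
  exact ((f.smooth 2).contDiffAt (x := x)).isSymmSndFDerivAt (by simp) _ _

lemma lap_eq_sum_sd (f : 𝓢(Euc N, ℂ)) (x : Euc N) :
    lap (fun y => f y) x = ∑ j, sd j (sd j f) x := by
  refine Finset.sum_congr rfl fun j _ => ?_
  have e : (sd j f : Euc N → ℂ) = fun y => fderiv ℝ f y (stdVec j) := funext (sd_apply j f)
  rw [sd_apply, e]

lemma hasLineDerivAt_sd (f : 𝓢(Euc N, ℂ)) (k : Fin N) (x : Euc N) :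
    HasLineDerivAt ℝ f (sd k f x) x (stdVec k) := by
  rw [sd_apply]
  exact (f.differentiable x).hasFDerivAt.hasLineDerivAt _

end Schwartz

section Pairing
variable {N : ℕ}

open ComplexConjugate

lemma one_add_rpow_eq (n : ℕ) (x : Euc N) :
    (1 + ‖x‖) ^ (-((n : ℝ) + 1)) = ((1 + ‖x‖) ^ (n + 1))⁻¹ := by
  rw [Real.rpow_neg (by positivity)]; norm_cast

/-- A polynomially growing factor is absorbed by a Schwartz-type bound. -/
lemma mul_le_of_growth_of_decay {C A r y z : ℝ} {M K : ℕ} (hr : 1 ≤ r) (hC : 0 ≤ C) (hz : 0 ≤ z)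
    (h1 : y ≤ C * r ^ M) (h2 : r ^ (M + K) * z ≤ A) : y * z ≤ C * A * (r ^ K)⁻¹ := by
  have hr0 : 0 < r ^ K := by positivity
  rw [← div_eq_mul_inv, le_div_iff₀ hr0]
  calc y * z * r ^ K ≤ C * r ^ M * z * r ^ K := by gcongr
    _ = C * (r ^ (M + K) * z) := by ring
    _ ≤ C * A := by gcongr

lemma le_mul_majorant {b : ℝ} {x : Euc N} {y v C A : ℝ} (hv : v ≤ A * (1 + ‖x‖ ^ (-b)))
    (hA : 0 ≤ A) (hy0 : 0 ≤ y) (hy : y ≤ C * ((1 + ‖x‖) ^ (N + 1))⁻¹) :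
    v * y ≤ A * C * majorant N b x := by
  unfold majorant
  rw [one_add_rpow_eq]
  calc v * y ≤ A * (1 + ‖x‖ ^ (-b)) * (C * ((1 + ‖x‖) ^ (N + 1))⁻¹) := by gcongr
    _ = _ := by ring

lemma integrable_one_add_pow_inv : Integrable (fun x : Euc N => ((1 + ‖x‖) ^ (N + 1))⁻¹) := by
  have := integrable_one_add_norm (E := Euc N) (μ := volume) (r := (N : ℝ) + 1) (by simp)
  simpa only [one_add_rpow_eq] using this

lemma PolyGrowth.exists_norm_mul_le {n : ℕ} {a : Euc N → ℝ} (ha : PolyGrowth n a)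
    (f : 𝓢(Euc N, ℂ)) (K : ℕ) :
    ∃ C : ℝ, 0 ≤ C ∧ ∀ x, ‖a x‖ * ‖f x‖ ≤ C * ((1 + ‖x‖) ^ K)⁻¹ := by
  obtain ⟨C, M, hC0, hC⟩ := ha.norm_le
  obtain ⟨A, hA0, hA⟩ := exists_one_add_pow_mul_le f (M + K)
  exact ⟨C * A, by positivity, fun x => mul_le_of_growth_of_decay (by simp) hC0
    (norm_nonneg _) (hC x) (hA x)⟩

/-- The integral `∫ a f̄ g`. -/
def wpair (a : Euc N → ℝ) (f g : 𝓢(Euc N, ℂ)) : ℂ := ∫ x, (a x : ℂ) * (conj (f x) * g x)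

lemma PolyGrowth.integrable_wpair {n : ℕ} {a : Euc N → ℝ} (ha : PolyGrowth n a)
    (f g : 𝓢(Euc N, ℂ)) : Integrable (fun x => (a x : ℂ) * (conj (f x) * g x)) := by
  obtain ⟨C, hC0, hC⟩ := ha.exists_norm_mul_le f (N + 1)
  obtain ⟨A, hA0, hA⟩ := exists_norm_le g
  refine (integrable_one_add_pow_inv.const_mul (C * A)).mono' ?_ (Eventually.of_forall fun x => ?_)
  · have := ha.continuous
    have := f.continuous
    have := g.continuous
    exact Continuous.aestronglyMeasurable (by fun_prop)
  · rw [norm_mul, norm_mul, Complex.norm_real, RCLike.norm_conj, ← mul_assoc]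
    calc _ ≤ (C * ((1 + ‖x‖) ^ (N + 1))⁻¹) * A := by gcongr ?_ * ?_; exacts [hC x, hA x]
      _ = _ := by ring

lemma conj_wpair (a : Euc N → ℝ) (f g : 𝓢(Euc N, ℂ)) :
    conj (wpair a f g) = wpair a g f := by
  unfold wpair
  rw [← integral_conj]
  congr 1; ext x
  simp [mul_comm]

lemma wpair_re_comm (a : Euc N → ℝ) (f g : 𝓢(Euc N, ℂ)) :
    (wpair a f g).re = (wpair a g f).re := by rw [← conj_wpair]; simp

lemma wpair_im_comm (a : Euc N → ℝ) (f g : 𝓢(Euc N, ℂ)) :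
    (wpair a f g).im = -(wpair a g f).im := by rw [← conj_wpair]; simp

lemma PolyGrowth.wpair_sub_left {n : ℕ} {a : Euc N → ℝ} (ha : PolyGrowth n a)
    (f f' g : 𝓢(Euc N, ℂ)) : wpair a (f - f') g = wpair a f g - wpair a f' g := by
  unfold wpair
  rw [← integral_sub (ha.integrable_wpair _ _) (ha.integrable_wpair _ _)]
  congr 1; ext x; simp; ring

lemma PolyGrowth.wpair_add_right {n : ℕ} {a : Euc N → ℝ} (ha : PolyGrowth n a)
    (f g g' : 𝓢(Euc N, ℂ)) : wpair a f (g + g') = wpair a f g + wpair a f g' := by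
  unfold wpair
  rw [← integral_add (ha.integrable_wpair _ _) (ha.integrable_wpair _ _)]
  congr 1; ext x; simp; ring

lemma wpair_sum {ι : Type*} {s : Finset ι} {n : ℕ} {a : ι → Euc N → ℝ}
    (ha : ∀ i, PolyGrowth n (a i)) (f g : 𝓢(Euc N, ℂ)) :
    wpair (fun x => ∑ i ∈ s, a i x) f g = ∑ i ∈ s, wpair (a i) f g := by
  unfold wpair
  rw [← integral_finsetSum _ fun i _ => (ha i).integrable_wpair f g]
  congr 1; ext x; push_cast; rw [Finset.sum_mul]

lemma wpair_lapR {n : ℕ} {a : Euc N → ℝ} (ha : PolyGrowth (n + 2) a) (f g : 𝓢(Euc N, ℂ)) :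
    wpair (lapR a) f g = ∑ i, wpair (pd i (pd i a)) f g :=
  wpair_sum (fun i => PolyGrowth.partialDeriv (PolyGrowth.partialDeriv (n := n + 1) ha i) i) f g

/-- Integration by parts when all three products are integrable. -/
lemma integral_smul_lineDeriv {F : Type*} [NormedAddCommGroup F] [NormedSpace ℝ F]
    {a a' : Euc N → ℝ} {h h' : Euc N → F} {v : Euc N}
    (ha : ∀ x, HasLineDerivAt ℝ a (a' x) x v) (hh : ∀ x, HasLineDerivAt ℝ h (h' x) x v)
    (i1 : Integrable fun x => a' x • h x) (i2 : Integrable fun x => a x • h' x)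
    (i3 : Integrable fun x => a x • h x) :
    ∫ x, a x • h' x = -∫ x, a' x • h x :=
  integral_bilinear_hasLineDerivAt_right_eq_neg_left_of_integrable
    (B := ContinuousLinearMap.lsmul ℝ ℝ) i1 i2 i3 (fun x _ => ha x) (fun x _ => hh x)

lemma hasLineDerivAt_conj_mul (f g : 𝓢(Euc N, ℂ)) (k : Fin N) (x : Euc N) :
    HasLineDerivAt ℝ (fun y => conj (f y) * g y) (conj (sd k f x) * g x + conj (f x) * sd k g x)
      x (stdVec k) := by
  have hf := hasLineDerivAt_sd f k x
  have hg := hasLineDerivAt_sd g k x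
  unfold HasLineDerivAt at *
  have := (Complex.conjCLE.toContinuousLinearMap.hasFDerivAt.comp_hasDerivAt _ hf).mul hg
  exact this.congr_deriv (by simp)

/-- Integration by parts for `wpair`. -/
lemma PolyGrowth.wpair_by_parts {n : ℕ} {a : Euc N → ℝ} (ha : PolyGrowth (n + 1) a)
    (k : Fin N) (f g : 𝓢(Euc N, ℂ)) :
    wpair (pd k a) f g + wpair a (sd k f) g + wpair a f (sd k g) = 0 := by
  have h := integral_smul_lineDeriv (fun x => ha.hasLineDerivAt k x)
    (fun x => hasLineDerivAt_conj_mul f g k x)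
    (by simpa using (ha.partialDeriv k).integrable_wpair f g)
    (by
      refine ((ha.integrable_wpair (sd k f) g).add (ha.integrable_wpair f (sd k g))).congr ?_
      exact Eventually.of_forall fun x => by simp)
    (by simpa using ha.integrable_wpair f g)
  unfold wpair
  simp only [Complex.real_smul, mul_add] at h
  rw [integral_add (ha.integrable_wpair _ _) (ha.integrable_wpair _ _)] at h
  rw [add_assoc, h, add_neg_cancel]

/-- The imaginary part of the momentum identity. -/
lemma PolyGrowth.im_sum_wpair_laplacian {n : ℕ} {φ : Euc N → ℝ} (hφ : PolyGrowth (n + 1) φ)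
    (u : 𝓢(Euc N, ℂ)) :
    (∑ j, wpair φ (sd j (sd j u)) u).im = (∑ j, wpair (pd j φ) u (sd j u)).im := by
  rw [Complex.im_sum, Complex.im_sum]
  refine Finset.sum_congr rfl fun j _ => ?_
  have h := congrArg Complex.im (hφ.wpair_by_parts j (sd j u) u)
  have h1 := wpair_im_comm φ (sd j u) (sd j u)
  have h2 := wpair_im_comm (pd j φ) (sd j u) u
  simp only [Complex.add_im, Complex.zero_im] at h
  linarith

/-- The increment of the momentum `Im ∫ ∇φ · ū ∇u` is controlled by the increment of `u` alone. -/
lemma PolyGrowth.momentum_sub {n : ℕ} {φ : Euc N → ℝ} (hφ : PolyGrowth (n + 2) φ)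
    (v w : 𝓢(Euc N, ℂ)) :
    (∑ j, wpair (pd j φ) v (sd j v)).im - (∑ j, wpair (pd j φ) w (sd j w)).im =
      (∑ j, wpair (pd j φ) (v - w) (sd j v + sd j w) +
        (1 / 2) * wpair (lapR φ) (v - w) (v + w)).im := by
  have hφ1 (j : Fin N) : PolyGrowth (n + 1) (pd j φ) := PolyGrowth.partialDeriv (n := n + 1) hφ j
  have hL : PolyGrowth n (lapR φ) := hφ.laplacian
  have e : (1 / 2 * wpair (lapR φ) (v - w) (v + w)).im =
      ∑ j, (wpair (pd j (pd j φ)) v w).im := by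
    rw [← Complex.im_sum, ← wpair_lapR hφ, hL.wpair_sub_left, hL.wpair_add_right,
      hL.wpair_add_right]
    have h1 := wpair_im_comm (lapR φ) v v
    have h2 := wpair_im_comm (lapR φ) w w
    have h3 := wpair_im_comm (lapR φ) w v
    simp
    linarith
  rw [Complex.add_im, e]
  simp only [Complex.im_sum, ← Finset.sum_sub_distrib, ← Finset.sum_add_distrib]
  refine Finset.sum_congr rfl fun j _ => ?_
  have h := congrArg Complex.im ((hφ1 j).wpair_by_parts j v w)
  rw [(hφ1 j).wpair_sub_left, (hφ1 j).wpair_add_right, (hφ1 j).wpair_add_right]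
  have h1 := wpair_im_comm (pd j φ) w (sd j v)
  simp only [Complex.add_im, Complex.sub_im, Complex.zero_im] at h ⊢
  linarith

/-- The real part of the linear virial identity. -/
lemma PolyGrowth.linear_virial {φ : Euc N → ℝ} (hφ : PolyGrowth 4 φ) (u : 𝓢(Euc N, ℂ)) :
    4 * (∑ j, ∑ k, wpair (pd k φ) (sd j (sd j u)) (sd k u) +
        (1 / 2) * ∑ j, wpair (lapR φ) (sd j (sd j u)) u).re =
      (wpair (lapR (lapR φ)) u u).re -
        4 * (∑ j, ∑ k, wpair (pd j (pd k φ)) (sd k u) (sd j u)).re := by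
  have hφ1 (j : Fin N) : PolyGrowth 3 (pd j φ) := PolyGrowth.partialDeriv hφ j
  have hL : PolyGrowth 2 (lapR φ) := hφ.laplacian
  have hL1 (j : Fin N) : PolyGrowth 1 (pd j (lapR φ)) := PolyGrowth.partialDeriv hL j
  have hb (j k : Fin N) : (wpair (pd k φ) (sd j (sd j u)) (sd k u)).re =
      -(wpair (pd j (pd k φ)) (sd k u) (sd j u)).re +
        1 / 2 * (wpair (pd k (pd k φ)) (sd j u) (sd j u)).re := by
    have h1 := congrArg Complex.re ((hφ1 k).wpair_by_parts j (sd j u) (sd k u))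
    have h2 := congrArg Complex.re ((hφ1 k).wpair_by_parts k (sd j u) (sd j u))
    have h3 := wpair_re_comm (pd k φ) (sd k (sd j u)) (sd j u)
    have h4 := wpair_re_comm (pd j (pd k φ)) (sd k u) (sd j u)
    rw [sd_comm j k] at h1
    simp only [Complex.add_re, Complex.zero_re] at h1 h2
    linarith
  have he (j : Fin N) : (wpair (lapR φ) (sd j (sd j u)) u).re =
      1 / 2 * (wpair (pd j (pd j (lapR φ))) u u).re -
        ∑ k, (wpair (pd k (pd k φ)) (sd j u) (sd j u)).re := by
    have h1 := congrArg Complex.re (hL.wpair_by_parts j (sd j u) u)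
    have h2 := congrArg Complex.re ((hL1 j).wpair_by_parts j u u)
    have h3 := wpair_re_comm (pd j (lapR φ)) (sd j u) u
    have h4 := congrArg Complex.re (wpair_lapR hφ (sd j u) (sd j u))
    rw [Complex.re_sum] at h4
    simp only [Complex.add_re, Complex.zero_re] at h1 h2
    linarith
  have hre (z : ℂ) : (1 / 2 * z).re = 1 / 2 * z.re := by simp
  rw [Complex.add_re, hre, wpair_lapR (n := 0) hL]
  simp only [Complex.re_sum, hb, he, Finset.sum_add_distrib, Finset.sum_sub_distrib,
    ← Finset.mul_sum, Finset.sum_neg_distrib]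
  ring

end Pairing

section Nonlinear
variable {N : ℕ}

open ComplexConjugate

/-- Removing the regularization `(‖x‖² + ε)^(-s/2)` of the singular weight `‖x‖^(-s)`. -/
lemma regularized_weight (hN : 1 ≤ N) {b s : ℝ} (hb0 : 0 < b) (hb : b < N) (hs : 0 < s)
    {h : Euc N → ℝ} (hc : Continuous h) {C : ℝ}
    (hC : ∀ x, x ≠ 0 → ‖x‖ ^ (-s) * |h x| ≤ C * majorant N b x) :
    Integrable (fun x => ‖x‖ ^ (-s) * h x) ∧
    (∀ ε : ℝ, 0 < ε → Integrable (fun x => (‖x‖ ^ 2 + ε) ^ (-s / 2) * h x)) ∧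
    Tendsto (fun n : ℕ => ∫ x, (‖x‖ ^ 2 + 1 / ((n : ℝ) + 1)) ^ (-s / 2) * h x) atTop
      (𝓝 (∫ x, ‖x‖ ^ (-s) * h x)) := by
  have sq (x : Euc N) : (‖x‖ ^ 2) ^ (-s / 2) = ‖x‖ ^ (-s) := by
    rw [← Real.rpow_natCast, ← Real.rpow_mul (norm_nonneg x)]; congr 1; push_cast; ring
  have meas (ε : ℝ) :
      AEStronglyMeasurable (fun x : Euc N => (‖x‖ ^ 2 + ε) ^ (-s / 2) * h x) volume :=
    (Measurable.mul (by fun_prop) hc.measurable).aestronglyMeasurable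
  have bnd {ε : ℝ} (hε : 0 ≤ ε) (x : Euc N) (hx : x ≠ 0) :
      ‖(‖x‖ ^ 2 + ε) ^ (-s / 2) * h x‖ ≤ C * majorant N b x := by
    have hx0 : 0 < ‖x‖ := norm_pos_iff.2 hx
    refine le_trans ?_ (hC x hx)
    rw [norm_mul, Real.norm_of_nonneg (by positivity), Real.norm_eq_abs, ← sq]
    exact mul_le_mul_of_nonneg_right
      (Real.rpow_le_rpow_of_nonpos (by positivity) (by linarith) (by linarith)) (abs_nonneg _)
  refine ⟨?_, fun ε hε => integrable_of_le_majorant hN hb0 hb (meas ε) C (bnd hε.le), ?_⟩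
  · refine (integrable_of_le_majorant hN hb0 hb (meas 0) C (bnd le_rfl)).congr ?_
    exact Eventually.of_forall fun x => by simp only [add_zero, sq]
  · refine tendsto_integral_filter_of_dominated_convergence (fun x => C * majorant N b x)
      (Eventually.of_forall fun n => meas _)
      (Eventually.of_forall fun n => (ae_ne_zero hN).mono fun x hx => bnd (by positivity) x hx)
      ((integrable_majorant hN hb0 hb).const_mul C) ?_
    refine (ae_ne_zero hN).mono fun x hx => ?_
    have h1 : Tendsto (fun n : ℕ => ‖x‖ ^ 2 + 1 / ((n : ℝ) + 1)) atTop (𝓝 (‖x‖ ^ 2)) := by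
      simpa using tendsto_one_div_add_atTop_nhds_zero_nat.const_add (‖x‖ ^ 2)
    have h2 := (h1.rpow_const (p := -s / 2)
      (Or.inl (pow_ne_zero 2 (norm_ne_zero_iff.2 hx)))).mul_const (h x)
    rwa [sq] at h2

lemma hasLineDerivAt_regularized (s : ℝ) {ε : ℝ} (hε : 0 < ε) (k : Fin N) (x : Euc N) :
    HasLineDerivAt ℝ (fun y : Euc N => (‖y‖ ^ 2 + ε) ^ (-s / 2))
      (-s * x k * (‖x‖ ^ 2 + ε) ^ (-(s + 2) / 2)) x (stdVec k) := by
  have h := ((hasStrictFDerivAt_norm_sq x).hasFDerivAt.add_const ε).rpow_const (p := -s / 2)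
    (Or.inl (by positivity))
  have h2 := h.hasLineDerivAt (stdVec k)
  refine HasDerivAt.congr_deriv h2 ?_
  rw [show -(s + 2) / 2 = -s / 2 - 1 by ring]
  simp [EuclideanSpace.inner_single_right]
  ring

lemma hasLineDerivAt_norm_rpow {p : ℝ} (hp : 1 < p) (u : 𝓢(Euc N, ℂ)) (k : Fin N) (x : Euc N) :
    HasLineDerivAt ℝ (fun y => ‖u y‖ ^ (p + 1))
      ((p + 1) * (‖u x‖ ^ (p - 1) * (conj (u x) * sd k u x).re)) x (stdVec k) := by
  have h := hasLineDerivAt_sd u k x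
  unfold HasLineDerivAt at *
  have e : u x = u (x + (0 : ℝ) • stdVec k) := by simp
  have h2 := (hasFDerivAt_norm_rpow (u (x + (0 : ℝ) • stdVec k))
    (by linarith : 1 < p + 1)).comp_hasDerivAt _ h
  refine h2.congr_deriv ?_
  rw [← e]
  simp only [smul_apply, innerSL_apply_apply, Complex.inner, smul_eq_mul]
  rw [show p + 1 - 2 = p - 1 by ring, mul_assoc, mul_comm (conj (u x))]

lemma rpow_add_one_eq {p : ℝ} (hp : 1 < p) (z : ℂ) :
    ‖z‖ ^ (p + 1) = ‖z‖ ^ (p - 1) * (conj z * z).re := by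
  rw [mul_comm (conj z), Complex.mul_conj, Complex.ofReal_re, Complex.normSq_eq_norm_sq,
    ← Real.rpow_natCast, ← Real.rpow_add_of_nonneg (norm_nonneg z) (by linarith) (by norm_num)]
  congr 1; push_cast; ring

/-- Decay of the nonlinear densities. -/
lemma PolyGrowth.exists_density_le {n : ℕ} {a : Euc N → ℝ} (ha : PolyGrowth n a) {p : ℝ}
    (hp : 1 < p) (u f : 𝓢(Euc N, ℂ)) :
    ∃ C : ℝ, 0 ≤ C ∧ ∀ x, |a x| * (‖u x‖ ^ (p - 1) * (‖u x‖ * ‖f x‖)) ≤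
      C * ((1 + ‖x‖) ^ (N + 1))⁻¹ := by
  obtain ⟨C, hC0, hC⟩ := ha.exists_norm_mul_le f (N + 1)
  obtain ⟨A, hA0, hA⟩ := exists_norm_le u
  refine ⟨A ^ (p - 1) * A * C, by positivity, fun x => ?_⟩
  have h1 : ‖u x‖ ^ (p - 1) ≤ A ^ (p - 1) :=
    Real.rpow_le_rpow (norm_nonneg _) (hA x) (by linarith)
  calc _ = ‖u x‖ ^ (p - 1) * ‖u x‖ * (‖a x‖ * ‖f x‖) := by rw [Real.norm_eq_abs]; ring
    _ ≤ A ^ (p - 1) * A * (C * ((1 + ‖x‖) ^ (N + 1))⁻¹) := by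
      gcongr ?_ * ?_ * ?_
      exacts [hA x, hC x]
    _ = _ := by ring

lemma abs_re_conj_mul_le (z w : ℂ) : |(conj z * w).re| ≤ ‖z‖ * ‖w‖ := by
  simpa using Complex.abs_re_le_norm (conj z * w)

lemma continuous_density {p : ℝ} (hp : 1 < p) (u f : 𝓢(Euc N, ℂ)) :
    Continuous fun x => ‖u x‖ ^ (p - 1) * (conj (u x) * f x).re := by
  have hu := u.continuous
  have hf := f.continuous
  refine (hu.norm.rpow_const fun x => Or.inr (by linarith)).mul ?_
  exact Complex.continuous_re.comp (by fun_prop)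

lemma PolyGrowth.weighted_density_le {n : ℕ} {a : Euc N → ℝ} (ha : PolyGrowth n a) {b p : ℝ}
    (hp : 1 < p) (u f : 𝓢(Euc N, ℂ)) :
    ∃ C : ℝ, ∀ x, ‖x‖ ^ (-b) * (|a x| * (‖u x‖ ^ (p - 1) * (‖u x‖ * ‖f x‖))) ≤
      C * majorant N b x := by
  obtain ⟨C, hC0, hC⟩ := ha.exists_density_le hp u f
  refine ⟨1 * C, fun x => ?_⟩
  exact le_mul_majorant (by linarith) zero_le_one (by positivity) (hC x)

lemma PolyGrowth.weighted_abs_density_le {n : ℕ} {a : Euc N → ℝ} (ha : PolyGrowth n a) {b p : ℝ}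
    (hp : 1 < p) (u f : 𝓢(Euc N, ℂ)) :
    ∃ C : ℝ, ∀ x, ‖x‖ ^ (-b) * |a x * (‖u x‖ ^ (p - 1) * (conj (u x) * f x).re)| ≤
      C * majorant N b x := by
  obtain ⟨C, hC⟩ := ha.weighted_density_le (b := b) hp u f
  refine ⟨C, fun x => le_trans ?_ (hC x)⟩
  rw [abs_mul, abs_mul, abs_of_nonneg (by positivity : 0 ≤ ‖u x‖ ^ (p - 1))]
  gcongr
  exact abs_re_conj_mul_le _ _

lemma PolyGrowth.integrable_weighted_density (hN : 1 ≤ N) {n : ℕ} {a : Euc N → ℝ}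
    (ha : PolyGrowth n a) {b p : ℝ} (hb0 : 0 < b) (hb : b < N) (hp : 1 < p) (u f : 𝓢(Euc N, ℂ)) :
    Integrable fun x => ‖x‖ ^ (-b) * (a x * (‖u x‖ ^ (p - 1) * (conj (u x) * f x).re)) := by
  obtain ⟨C, hC⟩ := ha.weighted_abs_density_le (b := b) hp u f
  exact (regularized_weight hN hb0 hb hb0 (ha.continuous.mul (continuous_density hp u f))
    fun x _ => hC x).1

/-- Integration by parts against the singular weight `‖x‖^(-b)` with a coefficient vanishing at
the origin. -/
lemma PolyGrowth.nonlinear_by_parts (hN : 1 ≤ N) {a : Euc N → ℝ} (ha : PolyGrowth 1 a)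
    {A : ℝ} {m : ℕ} (hA : 0 ≤ A) (ha0 : ∀ x, |a x| ≤ A * (1 + ‖x‖) ^ m * ‖x‖)
    {b p : ℝ} (hb0 : 0 < b) (hb : b < N) (hp : 1 < p) (u : 𝓢(Euc N, ℂ)) (k : Fin N) :
    Integrable (fun x => ‖x‖ ^ (-(b + 2)) * (x k * a x * ‖u x‖ ^ (p + 1))) ∧
    (p + 1) * ∫ x, ‖x‖ ^ (-b) * (a x * (‖u x‖ ^ (p - 1) * (conj (u x) * sd k u x).re)) =
      -(∫ x, ‖x‖ ^ (-b) * (pd k a x * ‖u x‖ ^ (p + 1))) +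
        b * ∫ x, ‖x‖ ^ (-(b + 2)) * (x k * a x * ‖u x‖ ^ (p + 1)) := by
  have hg : Continuous fun x => ‖u x‖ ^ (p + 1) :=
    u.continuous.norm.rpow_const fun x => Or.inr (by linarith)
  have ha' : PolyGrowth 0 (pd k a) := ha.partialDeriv k
  obtain ⟨C1, hC1⟩ := ha.weighted_abs_density_le (b := b) hp u (sd k u)
  obtain ⟨C2, hC2⟩ := ha'.weighted_abs_density_le (b := b) hp u u
  obtain ⟨C4, hC4⟩ := ha.weighted_abs_density_le (b := b) hp u u
  simp only [← rpow_add_one_eq hp] at hC2 hC4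
  have hC3 : ∃ C3 : ℝ, ∀ x : Euc N, x ≠ 0 →
      ‖x‖ ^ (-(b + 2)) * |x k * a x * ‖u x‖ ^ (p + 1)| ≤ C3 * majorant N b x := by
    obtain ⟨B, hB0, hB⟩ := exists_one_add_pow_mul_le u (m + (N + 1))
    obtain ⟨D, hD0, hD⟩ := exists_norm_le u
    refine ⟨D ^ p * (A * B), fun x hx => ?_⟩
    have hx0 : 0 < ‖x‖ := norm_pos_iff.2 hx
    have h1 : A * (1 + ‖x‖) ^ m * ‖u x‖ ≤ A * B * ((1 + ‖x‖) ^ (N + 1))⁻¹ :=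
      mul_le_of_growth_of_decay (by simp) hA (norm_nonneg _) le_rfl (hB x)
    have h2 : ‖u x‖ ^ (p + 1) = ‖u x‖ ^ p * ‖u x‖ :=
      Real.rpow_add_one' (norm_nonneg _) (by linarith)
    have h3 : ‖x‖ ^ (-b) = ‖x‖ ^ (-(b + 2)) * (‖x‖ * ‖x‖) := by
      rw [show -b = -(b + 2) + (2 : ℕ) by push_cast; ring, Real.rpow_add hx0, Real.rpow_natCast]
      ring
    have h4 : ‖u x‖ ^ p ≤ D ^ p := Real.rpow_le_rpow (norm_nonneg _) (hD x) (by linarith)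
    have h5 : |x k| ≤ ‖x‖ := PiLp.norm_apply_le x k
    rw [abs_mul, abs_mul, abs_of_nonneg (by positivity : 0 ≤ ‖u x‖ ^ (p + 1)), h2]
    calc ‖x‖ ^ (-(b + 2)) * (|x k| * |a x| * (‖u x‖ ^ p * ‖u x‖))
        ≤ ‖x‖ ^ (-(b + 2)) * (‖x‖ * (A * (1 + ‖x‖) ^ m * ‖x‖) * (D ^ p * ‖u x‖)) := by
          gcongr; exact ha0 x
      _ = (D ^ p * ‖x‖ ^ (-b)) * (A * (1 + ‖x‖) ^ m * ‖u x‖) := by rw [h3]; ring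
      _ ≤ _ := le_mul_majorant (by gcongr; linarith) (by positivity) (by positivity) h1
  obtain ⟨C3, hC3⟩ := hC3
  have R1 := regularized_weight hN hb0 hb hb0
    (h := fun x => a x * (‖u x‖ ^ (p - 1) * (conj (u x) * sd k u x).re))
    (ha.continuous.mul (continuous_density hp u (sd k u))) fun x _ => hC1 x
  have R2 := regularized_weight hN hb0 hb hb0 (h := fun x => pd k a x * ‖u x‖ ^ (p + 1))
    (ha'.continuous.mul hg) fun x _ => hC2 x
  have R4 := regularized_weight hN hb0 hb hb0 (h := fun x => a x * ‖u x‖ ^ (p + 1))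
    (ha.continuous.mul hg) fun x _ => hC4 x
  have hk : Continuous fun x : Euc N => x k := by fun_prop
  have R3 := regularized_weight (s := b + 2) (h := fun x => x k * a x * ‖u x‖ ^ (p + 1)) hN hb0
    hb (by linarith)
    ((hk.mul ha.continuous).mul hg) hC3
  refine ⟨R3.1, ?_⟩
  have eqn (n : ℕ) :
      (p + 1) * ∫ x, (‖x‖ ^ 2 + 1 / ((n : ℝ) + 1)) ^ (-b / 2) *
        (a x * (‖u x‖ ^ (p - 1) * (conj (u x) * sd k u x).re)) =
      -(∫ x, (‖x‖ ^ 2 + 1 / ((n : ℝ) + 1)) ^ (-b / 2) * (pd k a x * ‖u x‖ ^ (p + 1))) +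
        b * ∫ x, (‖x‖ ^ 2 + 1 / ((n : ℝ) + 1)) ^ (-(b + 2) / 2) *
          (x k * a x * ‖u x‖ ^ (p + 1)) := by
    have hε : (0 : ℝ) < 1 / ((n : ℝ) + 1) := by positivity
    set ε : ℝ := 1 / ((n : ℝ) + 1)
    have hV (x : Euc N) : HasLineDerivAt ℝ (fun y : Euc N => (‖y‖ ^ 2 + ε) ^ (-b / 2) * a y)
        (-b * x k * (‖x‖ ^ 2 + ε) ^ (-(b + 2) / 2) * a x + (‖x‖ ^ 2 + ε) ^ (-b / 2) * pd k a x) x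
        (stdVec k) := by
      have h1 := hasLineDerivAt_regularized b hε k x
      have h2 := ha.hasLineDerivAt k x
      unfold HasLineDerivAt at *
      exact (h1.mul h2).congr_deriv (by simp)
    have J2 := R2.2.1 ε hε
    have J3 := (R3.2.1 ε hε).const_mul b
    have h := integral_smul_lineDeriv hV (fun x => hasLineDerivAt_norm_rpow hp u k x)
      ((J2.sub J3).congr (Eventually.of_forall fun x => by simp; ring))
      (((R1.2.1 ε hε).const_mul (p + 1)).congr (Eventually.of_forall fun x => by simp; ring))
      ((R4.2.1 ε hε).congr (Eventually.of_forall fun x => by simp; ring))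
    rw [← integral_const_mul, ← integral_const_mul]
    refine Eq.trans (integral_congr_ae (Eventually.of_forall fun x => ?_)) (h.trans ?_)
    · simp only [smul_eq_mul]; ring
    · have e := integral_sub J2 J3
      rw [neg_add_eq_sub, ← neg_sub (integral _ _), ← e]
      congr 2; ext x; simp only [smul_eq_mul]; ring
  exact tendsto_nhds_unique ((R1.2.2.const_mul (p + 1)).congr eqn)
    (R2.2.2.neg.add (R3.2.2.const_mul b))

end Nonlinear

section Evolution
variable {N : ℕ} {b p : ℝ} {J : Set ℝ}

open ComplexConjugate

/-- The time derivative prescribed by (INLS). -/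
def inlsVelocity (b p : ℝ) (v : 𝓢(Euc N, ℂ)) (x : Euc N) : ℂ :=
  Complex.I * (lap (fun y => v y) x + ((‖x‖ ^ (-b) * ‖v x‖ ^ (p - 1) : ℝ) : ℂ) * v x)

/-- The nonlinear pairing `∫ |x|^{-b} a |v|^{p-1} v̄ f`. -/
def nonlinearPairing (b p : ℝ) (a : Euc N → ℝ) (v f : 𝓢(Euc N, ℂ)) : ℂ :=
  ∫ x, ((‖x‖ ^ (-b) * (a x * ‖v x‖ ^ (p - 1)) : ℝ) : ℂ) * (conj (v x) * f x)

lemma PolyGrowth.integrable_nonlinearPairing (hN : 1 ≤ N) (hb0 : 0 < b) (hb : b < N) (hp : 1 < p)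
    {n : ℕ} {a : Euc N → ℝ} (ha : PolyGrowth n a) (v f : 𝓢(Euc N, ℂ)) :
    Integrable fun x => ((‖x‖ ^ (-b) * (a x * ‖v x‖ ^ (p - 1)) : ℝ) : ℂ) *
      (conj (v x) * f x) := by
  obtain ⟨C, hC⟩ := ha.weighted_density_le (b := b) hp v f
  have h1 := ha.continuous.measurable
  have h2 := v.continuous.measurable
  have h3 := f.continuous.measurable
  have h4 : Measurable fun x => conj (v x) :=
    (Complex.continuous_conj.comp v.continuous).measurable
  refine integrable_of_le_majorant hN hb0 hb (Measurable.aestronglyMeasurable (by fun_prop)) C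
    fun x _ => le_of_eq_of_le ?_ (hC x)
  rw [norm_mul, norm_mul, Complex.norm_real, RCLike.norm_conj, Real.norm_eq_abs, abs_mul, abs_mul,
    abs_of_nonneg (by positivity : 0 ≤ ‖x‖ ^ (-b)),
    abs_of_nonneg (by positivity : 0 ≤ ‖v x‖ ^ (p - 1))]
  ring

lemma PolyGrowth.nonlinearPairing_re (hN : 1 ≤ N) (hb0 : 0 < b) (hb : b < N) (hp : 1 < p)
    {n : ℕ} {a : Euc N → ℝ} (ha : PolyGrowth n a) (v f : 𝓢(Euc N, ℂ)) :
    (nonlinearPairing b p a v f).re =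
      ∫ x, ‖x‖ ^ (-b) * (a x * (‖v x‖ ^ (p - 1) * (conj (v x) * f x).re)) := by
  have h := integral_re (ha.integrable_nonlinearPairing hN hb0 hb hp v f)
  unfold nonlinearPairing
  refine Eq.trans h.symm (integral_congr_ae (Eventually.of_forall fun x => ?_))
  simp only [RCLike.re_eq_complex_re, Complex.re_ofReal_mul]
  ring

lemma nonlinearPairing_self_im (a : Euc N → ℝ) (v : 𝓢(Euc N, ℂ)) :
    (nonlinearPairing b p a v v).im = 0 := by
  have e : nonlinearPairing b p a v v =
      ∫ x, ((‖x‖ ^ (-b) * (a x * ‖v x‖ ^ (p - 1)) * Complex.normSq (v x) : ℝ) : ℂ) := by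
    unfold nonlinearPairing
    congr 1; ext x
    rw [mul_comm (conj (v x)), Complex.mul_conj]
    push_cast; ring
  rw [e, integral_complex_ofReal, Complex.ofReal_im]

lemma PolyGrowth.integral_inlsVelocity (hN : 1 ≤ N) (hb0 : 0 < b) (hb : b < N) (hp : 1 < p)
    {n : ℕ} {a : Euc N → ℝ} (ha : PolyGrowth n a) (v f : 𝓢(Euc N, ℂ)) :
    ∫ x, (a x : ℂ) * (conj (inlsVelocity b p v x) * (f x + f x)) =
      -2 * Complex.I * (∑ j, wpair a (sd j (sd j v)) f + nonlinearPairing b p a v f) := by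
  unfold wpair nonlinearPairing
  rw [← integral_finsetSum _ fun j _ => ha.integrable_wpair (sd j (sd j v)) f,
    ← integral_add (integrable_finsetSum _ fun j _ => ha.integrable_wpair (sd j (sd j v)) f)
      (ha.integrable_nonlinearPairing hN hb0 hb hp v f), ← integral_const_mul]
  congr 1; ext x
  rw [inlsVelocity, lap_eq_sum_sd, ← Finset.mul_sum, ← Finset.sum_mul, ← map_sum]
  simp only [map_mul, map_add, Complex.conj_I, Complex.conj_ofReal]
  push_cast
  ring

lemma INLSSolution.hasDerivWithinAt (sol : INLSSolution N b p J) {t : ℝ} (ht : t ∈ J) {x : Euc N}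
    (hx : x ≠ 0) :
    HasDerivWithinAt (fun s => sol.u s x) (inlsVelocity b p (sol.u t) x) J t := by
  obtain ⟨ut, h1, h2⟩ := sol.eqn t ht x hx
  convert h1 using 1
  unfold inlsVelocity
  linear_combination Complex.I * h2 - ut * Complex.I_mul_I

lemma INLSSolution.uniform_decay (sol : INLSSolution N b p J) {K : Set ℝ} (hK : K ⊆ J)
    (hKc : IsCompact K) (k n : ℕ) :
    ∃ C : ℝ, 0 ≤ C ∧ ∀ s ∈ K, ∀ x, (1 + ‖x‖) ^ k * ‖iteratedFDeriv ℝ n (sol.u s) x‖ ≤ C := by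
  obtain ⟨C0, h0⟩ := sol.seminorm_bound K hK hKc 0 n
  obtain ⟨C1, h1⟩ := sol.seminorm_bound K hK hKc k n
  refine ⟨2 ^ (k - 1) * (|C0| + |C1|), by positivity, fun s hs x =>
    (one_add_pow_mul_le_seminorm (sol.u s) k n x).trans ?_⟩
  gcongr
  exacts [(h0 s hs).trans (le_abs_self _), (h1 s hs).trans (le_abs_self _)]

lemma INLSSolution.norm_inlsVelocity_le (sol : INLSSolution N b p J) (hp : 1 < p) {K : Set ℝ}
    (hK : K ⊆ J) (hKc : IsCompact K) :
    ∃ A : ℝ, 0 ≤ A ∧ ∀ s ∈ K, ∀ x, ‖inlsVelocity b p (sol.u s) x‖ ≤ A * (1 + ‖x‖ ^ (-b)) := by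
  obtain ⟨C, hC0, hC⟩ := sol.uniform_decay hK hKc 0 2
  obtain ⟨D, hD0, hD⟩ := sol.uniform_decay hK hKc 0 0
  simp only [pow_zero, one_mul, norm_iteratedFDeriv_zero] at hC hD
  refine ⟨N * C + D ^ (p - 1) * D, by positivity, fun s hs x => ?_⟩
  have h1 : ‖lap (fun y => sol.u s y) x‖ ≤ N * C := by
    rw [lap_eq_sum_sd]
    refine (norm_sum_le_of_le _ fun j _ => (norm_sd_sd_le j j _ x).trans (hC s hs x)).trans ?_
    simp
  have h2 : ‖sol.u s x‖ ^ (p - 1) ≤ D ^ (p - 1) :=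
    Real.rpow_le_rpow (norm_nonneg _) (hD s hs x) (by linarith)
  have h3 : 0 ≤ ‖x‖ ^ (-b) := by positivity
  have h4 : 0 ≤ D ^ (p - 1) * D := by positivity
  unfold inlsVelocity
  rw [norm_mul, Complex.norm_I, one_mul]
  refine (norm_add_le _ _).trans ?_
  rw [norm_mul, Complex.norm_real, Real.norm_of_nonneg (by positivity)]
  calc _ ≤ N * C + ‖x‖ ^ (-b) * D ^ (p - 1) * D := by
        gcongr
        exact hD s hs x
    _ ≤ _ := by nlinarith [mul_nonneg (mul_nonneg (Nat.cast_nonneg N : (0 : ℝ) ≤ N) hC0) h3]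

lemma INLSSolution.tendsto_apply (sol : INLSSolution N b p J) {t : ℝ} (ht : t ∈ J) (x : Euc N) :
    Tendsto (fun s => sol.u s x) (𝓝[J] t) (𝓝 (sol.u t x)) := by
  have h := sol.cont (t, x) ⟨ht, mem_univ _⟩
  have h2 : ContinuousWithinAt (fun s : ℝ => (s, x)) J t := by fun_prop
  exact ContinuousWithinAt.comp (f := fun s : ℝ => (s, x)) h h2 fun s hs => ⟨hs, mem_univ _⟩

lemma INLSSolution.tendsto_sd (sol : INLSSolution N b p J) (hJ : J.OrdConnected) {t : ℝ}
    (ht : t ∈ J) {x : Euc N} (hx : x ≠ 0) (j : Fin N) :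
    Tendsto (fun s => sd j (sol.u s) x) (𝓝[J \ {t}] t) (𝓝 (sd j (sol.u t) x)) := by
  rcases (J \ {t}).eq_empty_or_nonempty with he | ⟨r, hr⟩
  · simp [he]
  have hint : (interior J).Nonempty := by
    rcases lt_or_gt_of_ne hr.2 with h | h
    · exact ⟨(r + t) / 2, mem_interior.2 ⟨Ioo r t, Ioo_subset_Icc_self.trans (hJ.out hr.1 ht),
        isOpen_Ioo, by constructor <;> linarith⟩⟩
    · exact ⟨(r + t) / 2, mem_interior.2 ⟨Ioo t r, Ioo_subset_Icc_self.trans (hJ.out ht hr.1),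
        isOpen_Ioo, by constructor <;> linarith⟩⟩
  set f : ℝ × Euc N → ℂ := fun q => sol.u q.1 q.2
  set S : Set (ℝ × Euc N) := J ×ˢ {x : Euc N | x ≠ 0}
  have hS : UniqueDiffOn ℝ S := (uniqueDiffOn_convex hJ.convex hint).prod isOpen_ne.uniqueDiffOn
  have hc : ContinuousOn (fderivWithin ℝ f S) S :=
    sol.smooth.continuousOn_fderivWithin hS (by norm_cast)
  have hfd (s : ℝ) (hs : s ∈ J) : sd j (sol.u s) x = fderivWithin ℝ f S (s, x) (0, stdVec j) := by
    have h1 : HasFDerivWithinAt f (fderivWithin ℝ f S (s, x)) S (s, x) :=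
      (sol.smooth.differentiableOn (by norm_cast) (s, x) ⟨hs, hx⟩).hasFDerivWithinAt
    have h2 : HasFDerivWithinAt (fun y : Euc N => (s, y)) (ContinuousLinearMap.inr ℝ ℝ (Euc N))
        {x : Euc N | x ≠ 0} x := (hasFDerivAt_prodMk_right s x).hasFDerivWithinAt
    have h3 := (h1.comp (f := fun y : Euc N => (s, y)) x h2 fun y hy => ⟨hs, hy⟩).hasFDerivAt
      (isOpen_ne.mem_nhds hx)
    have h4 : HasFDerivAt (sol.u s)
      ((fderivWithin ℝ f S (s, x)).comp (ContinuousLinearMap.inr ℝ ℝ (Euc N))) x := h3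
    rw [sd_apply, h4.fderiv]
    simp
  have h2 : ContinuousWithinAt (fun s : ℝ => (s, x)) J t := by fun_prop
  have h3 := ContinuousWithinAt.comp (f := fun s : ℝ => (s, x)) (hc (t, x) ⟨ht, hx⟩) h2
    fun s hs => ⟨hs, hx⟩
  have h4 := (h3.clm_apply (continuousWithinAt_const (b := ((0 : ℝ), (stdVec j : Euc N))))).tendsto
  refine (Tendsto.congr' ?_ (h4.mono_left (nhdsWithin_mono t sdiff_subset))).trans_eq ?_
  · filter_upwards [self_mem_nhdsWithin] with s hs
    exact (hfd s hs.1).symm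
  · exact congrArg 𝓝 (hfd t ht).symm

lemma Set.OrdConnected.exists_Icc_mem_nhdsWithin (hJ : J.OrdConnected) {t : ℝ} (ht : t ∈ J) :
    ∃ a c, t ∈ Icc a c ∧ Icc a c ⊆ J ∧ Icc a c ∈ 𝓝[J] t := by
  have hl : ∃ a ∈ J, a ≤ t ∧ Ici a ∈ 𝓝[J] t := by
    by_cases h : ∃ a ∈ J, a < t
    · obtain ⟨a, ha, hat⟩ := h
      exact ⟨a, ha, hat.le, mem_nhdsWithin_of_mem_nhds (Ici_mem_nhds hat)⟩
    · push Not at h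
      exact ⟨t, ht, le_rfl, mem_of_superset self_mem_nhdsWithin h⟩
  have hr : ∃ c ∈ J, t ≤ c ∧ Iic c ∈ 𝓝[J] t := by
    by_cases h : ∃ c ∈ J, t < c
    · obtain ⟨c, hc, hct⟩ := h
      exact ⟨c, hc, hct.le, mem_nhdsWithin_of_mem_nhds (Iic_mem_nhds hct)⟩
    · push Not at h
      exact ⟨t, ht, le_rfl, mem_of_superset self_mem_nhdsWithin h⟩
  obtain ⟨a, ha, hat, ha'⟩ := hl
  obtain ⟨c, hc, hct, hc'⟩ := hr
  exact ⟨a, c, ⟨hat, hct⟩, hJ.out ha hc, inter_mem ha' hc'⟩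

/-- Difference quotients of `u` may be paired with polynomially weighted profiles. -/
lemma INLSSolution.tendsto_wpair (sol : INLSSolution N b p J) (hN : 1 ≤ N) (hb0 : 0 < b)
    (hb : b < N) (hp : 1 < p) (hJ : J.OrdConnected) {t : ℝ} (ht : t ∈ J) {n : ℕ} {a : Euc N → ℝ}
    (ha : PolyGrowth n a) {f : ℝ → 𝓢(Euc N, ℂ)}
    (hf : ∀ K ⊆ J, IsCompact K → ∀ k : ℕ, ∃ C : ℝ, ∀ s ∈ K, ∀ x, (1 + ‖x‖) ^ k * ‖f s x‖ ≤ C)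
    (hft : ∀ x, x ≠ 0 → Tendsto (fun s => f s x) (𝓝[J \ {t}] t) (𝓝 (f t x))) :
    Tendsto (fun s => (s - t)⁻¹ • wpair a (sol.u s - sol.u t) (f s + f t)) (𝓝[J \ {t}] t)
      (𝓝 (∫ x, (a x : ℂ) * (conj (inlsVelocity b p (sol.u t) x) * (f t x + f t x)))) := by
  obtain ⟨c, d, htK, hKJ, hK⟩ := hJ.exists_Icc_mem_nhdsWithin ht
  have hK' : ∀ᶠ s in 𝓝[J \ {t}] t, s ∈ Icc c d := nhdsWithin_mono t sdiff_subset hK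
  obtain ⟨A, hA0, hA⟩ := sol.norm_inlsVelocity_le hp hKJ isCompact_Icc
  obtain ⟨B, M, hB0, hB⟩ := ha.norm_le
  obtain ⟨C, hC⟩ := hf _ hKJ isCompact_Icc (M + (N + 1))
  simp only [wpair, ← integral_smul]
  refine tendsto_integral_filter_of_dominated_convergence
    (fun x => A * (B * (C + C)) * majorant N b x) ?_ ?_
    ((integrable_majorant hN hb0 hb).const_mul _) ?_
  · exact Eventually.of_forall fun s =>
      ((ha.integrable_wpair (sol.u s - sol.u t) (f s + f t)).aestronglyMeasurable).const_smul _
  · filter_upwards [hK'] with s hs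
    filter_upwards [ae_ne_zero hN] with x hx
    have h1 : ‖sol.u s x - sol.u t x‖ ≤ A * (1 + ‖x‖ ^ (-b)) * ‖s - t‖ :=
      Convex.norm_image_sub_le_of_norm_hasDerivWithin_le
        (f := fun r => sol.u r x) (f' := fun r => inlsVelocity b p (sol.u r) x)
        (fun r hr => (sol.hasDerivWithinAt (hKJ hr) hx).mono hKJ) (fun r hr => hA r hr x)
        (convex_Icc c d) htK hs
    have h2 : ‖(s - t)⁻¹‖ * ‖sol.u s x - sol.u t x‖ ≤ A * (1 + ‖x‖ ^ (-b)) := by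
      rcases eq_or_ne s t with rfl | hst
      · simp; positivity
      · rw [norm_inv, inv_mul_le_iff₀ (norm_pos_iff.2 (sub_ne_zero.2 hst))]
        linarith
    have h3 : ‖a x‖ * ‖f s x + f t x‖ ≤ B * (C + C) * ((1 + ‖x‖) ^ (N + 1))⁻¹ := by
      refine mul_le_of_growth_of_decay (by simp) hB0 (norm_nonneg _) (hB x) ?_
      calc _ ≤ (1 + ‖x‖) ^ (M + (N + 1)) * (‖f s x‖ + ‖f t x‖) := by
            gcongr; exact norm_add_le _ _
        _ ≤ _ := by rw [mul_add]; exact add_le_add (hC s hs x) (hC t htK x)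
    refine le_of_eq_of_le ?_ (le_mul_majorant h2 hA0 (by positivity) h3)
    rw [norm_smul, norm_mul, norm_mul, Complex.norm_real, RCLike.norm_conj, sub_apply, add_apply]
    ring
  · filter_upwards [ae_ne_zero hN] with x hx
    have h1 := (hasDerivWithinAt_iff_tendsto_slope.1 (sol.hasDerivWithinAt ht hx))
    have h2 := ((Complex.continuous_conj.tendsto _).comp h1).mul ((hft x hx).add_const (f t x))
    refine (h2.const_mul (a x : ℂ)).congr fun s => ?_
    simp only [Function.comp_apply, slope_def_module, Complex.real_smul, map_mul,
      Complex.conj_ofReal, sub_apply, add_apply]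
    ring

end Evolution

section Virial
variable {N : ℕ} {b p : ℝ} {J : Set ℝ}

open ComplexConjugate

lemma INLSSolution.tendsto_wpair_self (sol : INLSSolution N b p J) (hN : 1 ≤ N) (hb0 : 0 < b)
    (hb : b < N) (hp : 1 < p) (hJ : J.OrdConnected) {t : ℝ} (ht : t ∈ J) {n : ℕ} {a : Euc N → ℝ}
    (ha : PolyGrowth n a) :
    Tendsto (fun s => (s - t)⁻¹ • wpair a (sol.u s - sol.u t) (sol.u s + sol.u t)) (𝓝[J \ {t}] t)
      (𝓝 (-2 * Complex.I * (∑ j, wpair a (sd j (sd j (sol.u t))) (sol.u t) +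
        nonlinearPairing b p a (sol.u t) (sol.u t)))) := by
  rw [← ha.integral_inlsVelocity hN hb0 hb hp]
  refine sol.tendsto_wpair hN hb0 hb hp hJ ht ha (fun K hK hKc k => ?_)
    fun x _ => (sol.tendsto_apply ht x).mono_left (nhdsWithin_mono t sdiff_subset)
  obtain ⟨C, -, hC⟩ := sol.uniform_decay hK hKc k 0
  exact ⟨C, by simpa only [norm_iteratedFDeriv_zero] using hC⟩

lemma INLSSolution.tendsto_wpair_sd (sol : INLSSolution N b p J) (hN : 1 ≤ N) (hb0 : 0 < b)
    (hb : b < N) (hp : 1 < p) (hJ : J.OrdConnected) {t : ℝ} (ht : t ∈ J) {n : ℕ} {a : Euc N → ℝ}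
    (ha : PolyGrowth n a) (k : Fin N) :
    Tendsto (fun s => (s - t)⁻¹ • wpair a (sol.u s - sol.u t) (sd k (sol.u s) + sd k (sol.u t)))
      (𝓝[J \ {t}] t)
      (𝓝 (-2 * Complex.I * (∑ j, wpair a (sd j (sd j (sol.u t))) (sd k (sol.u t)) +
        nonlinearPairing b p a (sol.u t) (sd k (sol.u t))))) := by
  rw [← ha.integral_inlsVelocity hN hb0 hb hp]
  refine sol.tendsto_wpair hN hb0 hb hp hJ ht ha (f := fun s => sd k (sol.u s))
    (fun K hK hKc m => ?_) fun x hx => sol.tendsto_sd hJ ht hx k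
  obtain ⟨C, -, hC⟩ := sol.uniform_decay hK hKc m 1
  exact ⟨C, fun s hs x => le_trans (by gcongr; exact norm_sd_le k _ x) (hC s hs x)⟩

lemma integral_mul_norm_sq (a : Euc N → ℝ) (v : 𝓢(Euc N, ℂ)) :
    ∫ x, a x * ‖v x‖ ^ 2 = (wpair a v v).re := by
  have e : wpair a v v = ∫ x, ((a x * ‖v x‖ ^ 2 : ℝ) : ℂ) := by
    unfold wpair
    congr 1; ext x
    rw [mul_comm (conj (v x)), Complex.mul_conj, Complex.normSq_eq_norm_sq]
    push_cast; ring
  rw [e, integral_complex_ofReal, Complex.ofReal_re]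

/-- The first derivative of the localized virial quantity is the localized momentum. -/
lemma INLSSolution.hasDerivWithinAt_virial (sol : INLSSolution N b p J) (hN : 1 ≤ N) (hb0 : 0 < b)
    (hb : b < N) (hp : 1 < p) (hJ : J.OrdConnected) {t : ℝ} (ht : t ∈ J) {n : ℕ} {φ : Euc N → ℝ}
    (hφ : PolyGrowth (n + 1) φ) :
    HasDerivWithinAt (fun s => ∫ x, φ x * ‖sol.u s x‖ ^ 2)
      (2 * (∑ j, wpair (pd j φ) (sol.u t) (sd j (sol.u t))).im) J t := by
  rw [hasDerivWithinAt_iff_tendsto_slope, ← hφ.im_sum_wpair_laplacian]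
  refine (((Complex.continuous_re.tendsto _).comp
    (sol.tendsto_wpair_self hN hb0 hb hp hJ ht hφ)).congr fun s => ?_).trans_eq (congrArg 𝓝 ?_)
  · simp only [Function.comp_apply, slope_def_module, integral_mul_norm_sq, Complex.smul_re]
    rw [hφ.wpair_sub_left, hφ.wpair_add_right, hφ.wpair_add_right]
    simp only [Complex.sub_re, Complex.add_re]
    rw [wpair_re_comm φ (sol.u s) (sol.u t)]
    congr 1; ring
  · have h := nonlinearPairing_self_im (b := b) (p := p) φ (sol.u t)
    simp only [neg_mul, Complex.neg_re, Complex.mul_re, Complex.mul_im, Complex.re_ofNat,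
      Complex.im_ofNat, Complex.I_re, Complex.I_im, Complex.add_im, h]
    ring

/-- The derivative of the localized momentum, before integration by parts. -/
lemma INLSSolution.hasDerivWithinAt_momentum (sol : INLSSolution N b p J) (hN : 1 ≤ N)
    (hb0 : 0 < b) (hb : b < N) (hp : 1 < p) (hJ : J.OrdConnected) {t : ℝ} (ht : t ∈ J) {n : ℕ}
    {φ : Euc N → ℝ} (hφ : PolyGrowth (n + 2) φ) :
    HasDerivWithinAt (fun s => (∑ j, wpair (pd j φ) (sol.u s) (sd j (sol.u s))).im)
      (-2 * (∑ j, ∑ k, wpair (pd k φ) (sd j (sd j (sol.u t))) (sd k (sol.u t)) +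
          (1 / 2) * ∑ j, wpair (lapR φ) (sd j (sd j (sol.u t))) (sol.u t)).re -
        2 * (∑ k, (nonlinearPairing b p (pd k φ) (sol.u t) (sd k (sol.u t))).re +
          (1 / 2) * (nonlinearPairing b p (lapR φ) (sol.u t) (sol.u t)).re)) J t := by
  rw [hasDerivWithinAt_iff_tendsto_slope]
  have h1 := tendsto_finsetSum Finset.univ fun k _ => sol.tendsto_wpair_sd hN hb0 hb hp hJ ht
    (PolyGrowth.partialDeriv (n := n + 1) hφ k) k
  have h2 := (sol.tendsto_wpair_self hN hb0 hb hp hJ ht hφ.laplacian).const_mul (1 / 2)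
  refine (((Complex.continuous_im.tendsto _).comp (h1.add h2)).congr fun s => ?_).trans_eq
    (congrArg 𝓝 ?_)
  · simp only [Function.comp_apply, slope_def_module]
    rw [hφ.momentum_sub, ← Finset.smul_sum, mul_smul_comm, ← smul_add, Complex.smul_im]
  · rw [Finset.sum_comm, ← Finset.mul_sum, Finset.sum_add_distrib]
    have e (z w z' w' : ℂ) : (-2 * Complex.I * (z + w) + 1 / 2 * (-2 * Complex.I * (z' + w'))).im =
        -2 * (z + 1 / 2 * z').re - 2 * (w.re + 1 / 2 * w'.re) := by
      simp; ring
    rw [e, Complex.re_sum]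

/-- A polynomially growing `C¹` function vanishing at the origin is `O(‖x‖)` there. -/
lemma PolyGrowth.abs_le_of_apply_zero {n : ℕ} {a : Euc N → ℝ} (ha : PolyGrowth (n + 1) a)
    (h0 : a 0 = 0) :
    ∃ (A : ℝ) (m : ℕ), 0 ≤ A ∧ ∀ x, |a x| ≤ A * (1 + ‖x‖) ^ m * ‖x‖ := by
  obtain ⟨C, m, hC⟩ := ha.bound
  have hC0 : 0 ≤ C := by simpa using (norm_nonneg _).trans (hC 0 (Nat.zero_le _) 0)
  refine ⟨C, m, hC0, fun x => ?_⟩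
  have h := (convex_closedBall (0 : Euc N) ‖x‖).norm_image_sub_le_of_norm_fderiv_le (𝕜 := ℝ)
    (f := a) (C := C * (1 + ‖x‖) ^ m) (x := 0) (y := x)
    (fun y _ => ha.contDiff.differentiable (by norm_cast) y)
    (fun y hy => by
      rw [← norm_iteratedFDeriv_one]
      refine (hC 1 (by lia) y).trans ?_
      have : ‖y‖ ≤ ‖x‖ := by simpa using hy
      gcongr) (by simp) (by simp)
  simpa [h0] using h

/-- The nonlinear contribution to the localized virial identity. -/
lemma PolyGrowth.nonlinear_virial (hN : 1 ≤ N) {n : ℕ} {φ : Euc N → ℝ}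
    (hφ : PolyGrowth (n + 2) φ) (hφ0 : fderiv ℝ φ 0 = 0) (hb0 : 0 < b) (hb : b < N) (hp : 1 < p)
    (v : 𝓢(Euc N, ℂ)) :
    -4 * (∑ k, (nonlinearPairing b p (pd k φ) v (sd k v)).re +
        (1 / 2) * (nonlinearPairing b p (lapR φ) v v).re) =
      -(2 * (p - 1) / (p + 1) * ∫ x, ‖x‖ ^ (-b) * ‖v x‖ ^ (p + 1) * lapR φ x) +
        4 / (p + 1) * ∫ x, (-b * ‖x‖ ^ (-b - 2) * ∑ i, x i * pd i φ x) * ‖v x‖ ^ (p + 1) := by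
  have hp1 : p + 1 ≠ 0 := by linarith
  have hpd (k : Fin N) : PolyGrowth (n + 1) (pd k φ) := PolyGrowth.partialDeriv (n := n + 1) hφ k
  have hparts (k : Fin N) :
      Integrable (fun x => ‖x‖ ^ (-(b + 2)) * (x k * pd k φ x * ‖v x‖ ^ (p + 1))) ∧
      (p + 1) * (nonlinearPairing b p (pd k φ) v (sd k v)).re =
        -(∫ x, ‖x‖ ^ (-b) * (pd k (pd k φ) x * ‖v x‖ ^ (p + 1))) +
          b * ∫ x, ‖x‖ ^ (-(b + 2)) * (x k * pd k φ x * ‖v x‖ ^ (p + 1)) := by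
    obtain ⟨A, m, hA, h⟩ := (hpd k).abs_le_of_apply_zero (by simp [pd, hφ0])
    rw [(hpd k).nonlinearPairing_re hN hb0 hb hp]
    exact ((hpd k).mono (by lia)).nonlinear_by_parts hN hA h hb0 hb hp v k
  have hlap : ∑ k, ∫ x, ‖x‖ ^ (-b) * (pd k (pd k φ) x * ‖v x‖ ^ (p + 1)) =
      ∫ x, ‖x‖ ^ (-b) * ‖v x‖ ^ (p + 1) * lapR φ x := by
    rw [← integral_finsetSum]
    · congr 1; ext x
      rw [mul_comm (_ * _), lapR, Finset.sum_mul]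
      exact Finset.sum_congr rfl fun k _ => by unfold pd; ring
    · intro k _
      simp only [rpow_add_one_eq hp]
      exact ((hpd k).partialDeriv k).integrable_weighted_density hN hb0 hb hp v v
  have hself : (nonlinearPairing b p (lapR φ) v v).re =
      ∫ x, ‖x‖ ^ (-b) * ‖v x‖ ^ (p + 1) * lapR φ x := by
    rw [hφ.laplacian.nonlinearPairing_re hN hb0 hb hp]
    congr 1; ext x
    rw [rpow_add_one_eq hp]; ring
  have hgrad : ∫ x, (-b * ‖x‖ ^ (-b - 2) * ∑ i, x i * pd i φ x) * ‖v x‖ ^ (p + 1) =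
      -b * ∑ k, ∫ x, ‖x‖ ^ (-(b + 2)) * (x k * pd k φ x * ‖v x‖ ^ (p + 1)) := by
    rw [← integral_finsetSum _ fun k _ => (hparts k).1, ← integral_const_mul]
    congr 1; ext x
    rw [← Finset.mul_sum, ← Finset.sum_mul, neg_add']
    ring
  have hsum : (p + 1) * ∑ k, (nonlinearPairing b p (pd k φ) v (sd k v)).re =
      -(∫ x, ‖x‖ ^ (-b) * ‖v x‖ ^ (p + 1) * lapR φ x) +
        b * ∑ k, ∫ x, ‖x‖ ^ (-(b + 2)) * (x k * pd k φ x * ‖v x‖ ^ (p + 1)) := by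
    rw [← hlap, Finset.mul_sum, Finset.mul_sum, ← Finset.sum_neg_distrib, ← Finset.sum_add_distrib]
    exact Finset.sum_congr rfl fun k _ => (hparts k).2
  rw [hself, hgrad, eq_div_of_mul_eq hp1 ((mul_comm _ _).trans hsum)]
  field_simp
  ring

lemma PolyGrowth.integral_hessian {n : ℕ} {φ : Euc N → ℝ} (hφ : PolyGrowth (n + 2) φ)
    (v : 𝓢(Euc N, ℂ)) :
    ∫ x, ∑ j, ∑ k, (pd j (pd k φ) x : ℂ) * fderiv ℝ (fun y => v y) x (stdVec j) *
        conj (fderiv ℝ (fun y => v y) x (stdVec k)) =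
      ∑ j, ∑ k, wpair (pd j (pd k φ)) (sd k v) (sd j v) := by
  have h (j k : Fin N) := (PolyGrowth.partialDeriv (n := n)
    (PolyGrowth.partialDeriv (n := n + 1) hφ k) j).integrable_wpair (sd k v) (sd j v)
  unfold wpair
  simp only [← integral_finsetSum _ fun k _ => h _ k]
  rw [← integral_finsetSum _ fun j _ => integrable_finsetSum _ fun k _ => h j k]
  simp only [sd_apply]
  congr 1; ext x
  exact Finset.sum_congr rfl fun j _ => Finset.sum_congr rfl fun k _ => by ring

end Virial

/-- Second derivative of the localized virial quantity: for a classical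
Schwartz solution of (INLS) on an interval `J` and a `C⁴` weight `φ` with `∇φ(0) = 0` and
polynomially bounded derivatives up to order 4, `I(t) = ∫ φ|u(t,·)|² dx` is twice
differentiable on `J` with
`I''(t) = 4 Re ∑_{j,k} ∫ ∂_j∂_kφ ∂_j u ∂_k ū − ∫ |u|² Δ²φ − (2(p−1)/(p+1)) ∫ |x|^{-b}|u|^{p+1} Δφ
 + (4/(p+1)) ∫ ∇(|x|^{-b})·∇φ |u|^{p+1}`, where `∇(|x|^{-b}) = −b|x|^{-b-2}x`. -/
theorem stmt12 (N : ℕ) (hN : 1 ≤ N) (b p : ℝ) (hb1 : 0 < b) (hb2 : b < min 2 (N : ℝ))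
    (hp : 1 < p) (J : Set ℝ) (hJ : J.OrdConnected) (sol : INLSSolution N b p J)
    (φ : EuclideanSpace ℝ (Fin N) → ℝ) (hφ : ContDiff ℝ 4 φ)
    (hφ0 : fderiv ℝ φ 0 = 0)
    (hgrowth : ∃ (C : ℝ) (m : ℕ), ∀ x : EuclideanSpace ℝ (Fin N), ∀ k : ℕ, k ≤ 4 →
      ‖iteratedFDeriv ℝ k φ x‖ ≤ C * (1 + ‖x‖) ^ m) :
    ∃ I' : ℝ → ℝ,
      (∀ t ∈ J,
        HasDerivWithinAt
          (fun s => ∫ x : EuclideanSpace ℝ (Fin N), φ x * ‖sol.u s x‖ ^ 2) (I' t) J t) ∧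
      (∀ t ∈ J,
        HasDerivWithinAt I'
          (4 * (∫ x : EuclideanSpace ℝ (Fin N),
              ∑ j : Fin N, ∑ k : Fin N,
                ((fderiv ℝ (fun y => fderiv ℝ φ y (EuclideanSpace.single k 1)) x
                    (EuclideanSpace.single j 1) : ℝ) : ℂ) *
                  fderiv ℝ (fun y => sol.u t y) x (EuclideanSpace.single j 1) *
                  (starRingEnd ℂ)
                    (fderiv ℝ (fun y => sol.u t y) x (EuclideanSpace.single k 1))).re -
            (∫ x : EuclideanSpace ℝ (Fin N), ‖sol.u t x‖ ^ 2 * lapR (lapR φ) x) -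
            (2 * (p - 1) / (p + 1)) *
              (∫ x : EuclideanSpace ℝ (Fin N), ‖x‖ ^ (-b) * ‖sol.u t x‖ ^ (p + 1) * lapR φ x) +
            (4 / (p + 1)) *
              ∫ x : EuclideanSpace ℝ (Fin N),
                (-b * ‖x‖ ^ (-b - 2) *
                    ∑ i : Fin N, x i * fderiv ℝ φ x (EuclideanSpace.single i 1)) *
                  ‖sol.u t x‖ ^ (p + 1))
          J t) := by
  obtain ⟨hb, hbN⟩ := lt_min_iff.1 hb2
  have hpoly : PolyGrowth 4 φ :=
    ⟨hφ, let ⟨C, m, h⟩ := hgrowth; ⟨C, m, fun k hk x => h x k hk⟩⟩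
  refine ⟨fun t => 2 * (∑ j, wpair (pd j φ) (sol.u t) (sd j (sol.u t))).im,
    fun t ht => sol.hasDerivWithinAt_virial hN hb1 hbN hp hJ ht (n := 3) hpoly, fun t ht => ?_⟩
  refine ((sol.hasDerivWithinAt_momentum hN hb1 hbN hp hJ ht (n := 2) hpoly).const_mul
    2).congr_deriv ?_
  have h1 := hpoly.linear_virial (sol.u t)
  have h2 := PolyGrowth.nonlinear_virial hN (n := 2) hpoly hφ0 hb1 hbN hp (sol.u t)
  have h3 := congrArg Complex.re (PolyGrowth.integral_hessian (n := 2) hpoly (sol.u t))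
  have h4 := integral_mul_norm_sq (lapR (lapR φ)) (sol.u t)
  simp only [mul_comm (lapR (lapR φ) _)] at h4
  unfold pd at *
  linarith
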